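/- Let X be a complex Banach space, let φ ∈ BUC(ℝ,X), and let h > 0. Then M_h(g·φ) ∈ C₀(ℝ,X); that is, the function t ↦ (1/h)·∫₀^h g(t+s)·φ(t+s) ds is continuous and its norm tends to 0 as |t| → ∞. -/

import Mathlib

open Filter intervalIntegral

noncomputable def g (t : ℝ) : ℂ := Complex.exp (Complex.I * (t : ℂ) ^ 2)

theorem g_eq (t : ℝ) : g t = Complex.exp (((t ^ 2 : ℝ) : ℂ) * Complex.I) := by
  unfold g; congr 1; push_cast; ring

theorem g_norm (t : ℝ) : ‖g t‖ = 1 := by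
  rw [g_eq, Complex.norm_exp_ofReal_mul_I]

theorem g_cont : Continuous g := by
  unfold g; fun_prop

theorem g_shift (t s : ℝ) (ht : t ≠ 0) :
    g (t + (s + Real.pi / (2 * t))) = - (g (t + s) * Complex.exp (Complex.I *
      ((2 * s * (Real.pi / (2 * t)) + (Real.pi / (2 * t)) ^ 2 : ℝ) : ℂ))) := by
  have h1 : (t + (s + Real.pi / (2 * t))) ^ 2 = (t + s) ^ 2
      + (2 * s * (Real.pi / (2 * t)) + (Real.pi / (2 * t)) ^ 2) + Real.pi := by
    field_simp; ring
  rw [g_eq, g_eq, h1, ← Complex.exp_add, ← neg_one_mul, ← Complex.exp_pi_mul_I, ← Complex.exp_add]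
  congr 1
  push_cast
  ring

theorem key_bound {X : Type*} [NormedAddCommGroup X] [NormedSpace ℂ X] [CompleteSpace X]
    (φ : ℝ → X) (hc : Continuous φ) (C : ℝ) (hC : ∀ t, ‖φ t‖ ≤ C)
    (h : ℝ) (hh : 0 < h) (t : ℝ) (ht : t ≠ 0) (d : ℝ) (hd : d = Real.pi / (2 * t)) (ε : ℝ)
    (he : ∀ u, ‖φ (u + d) - φ u‖ ≤ ε) :
    2 * ‖∫ s in (0:ℝ)..h, g (t + s) • φ (t + s)‖ ≤
      (ε + C * (2 * h * |d| + |d| ^ 2)) * h + 2 * (C * |d|) := by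
  set f : ℝ → X := fun s => g (t + s) • φ (t + s) with hf
  have fc : Continuous f := by
    have := g_cont
    fun_prop
  have fn : ∀ s, ‖f s‖ ≤ C := fun s => by
    simp only [hf, norm_smul, g_norm, one_mul]; exact hC _
  have C0 : 0 ≤ C := (norm_nonneg _).trans (hC 0)
  have fi : ∀ a b, IntervalIntegrable f MeasureTheory.volume a b :=
    fun a b => fc.intervalIntegrable a b
  have e1 : ∫ s in (0:ℝ)..h, f (s + d) = (∫ s in (0:ℝ)..h, f s) + (∫ s in h..(h + d), f s)
      - ∫ s in (0:ℝ)..d, f s := by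
    rw [intervalIntegral.integral_comp_add_right, zero_add,
      integral_add_adjacent_intervals (fi _ _) (fi _ _),
      integral_interval_sub_left (fi _ _) (fi _ _)]
  have b1 : ‖∫ s in h..(h + d), f s‖ ≤ C * |d| := by
    have := norm_integral_le_of_norm_le_const (a := h) (b := h + d) (f := f) (C := C)
      (fun s _ => fn s)
    simpa using this
  have b2 : ‖∫ s in (0:ℝ)..d, f s‖ ≤ C * |d| := by
    have := norm_integral_le_of_norm_le_const (a := 0) (b := d) (f := f) (C := C)
      (fun s _ => fn s)
    simpa using this
  have b3 : ‖∫ s in (0:ℝ)..h, (f s + f (s + d))‖ ≤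
      (ε + C * (2 * h * |d| + |d| ^ 2)) * h := by
    have := norm_integral_le_of_norm_le_const (a := 0) (b := h) (f := fun s => f s + f (s + d))
      (C := ε + C * (2 * h * |d| + |d| ^ 2)) ?_
    · simpa [abs_of_pos hh] using this
    intro s hs
    rw [Set.uIoc_of_le hh.le] at hs
    set x : ℝ := 2 * s * d + d ^ 2 with hx
    have e2 : f s + f (s + d) = g (t + s) •
        ((1 - Complex.exp (Complex.I * (x : ℂ))) • φ (t + s + d)
          - (φ (t + s + d) - φ (t + s))) := by
      have := g_shift t s ht
      rw [← hd, ← hx] at this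
      simp only [hf]
      rw [this, ← add_assoc]
      module
    rw [e2, norm_smul, g_norm, one_mul]
    have e3 : ‖(1 - Complex.exp (Complex.I * (x : ℂ)))‖ ≤ 2 * h * |d| + |d| ^ 2 := by
      rw [norm_sub_rev]
      refine (Real.norm_exp_I_mul_ofReal_sub_one_le).trans ?_
      rw [hx, Real.norm_eq_abs]
      refine (abs_add_le _ _).trans ?_
      rw [abs_mul, abs_pow, abs_of_nonneg (by linarith [hs.1] : 0 ≤ 2 * s)]
      gcongr
      exact hs.2
    refine (norm_sub_le _ _).trans ?_
    rw [norm_smul, add_comm, mul_comm C]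
    gcongr
    · exact he _
    · exact hC _
  have e4 : ∫ s in (0:ℝ)..h, (f s + f (s + d)) = (∫ s in (0:ℝ)..h, f s)
      + ∫ s in (0:ℝ)..h, f (s + d) :=
    integral_add (fi _ _) ((fc.comp (continuous_id.add continuous_const)).intervalIntegrable _ _)
  set I := ∫ s in (0:ℝ)..h, f s
  have e5 : (2:ℂ) • I = (∫ s in (0:ℝ)..h, (f s + f (s + d))) - (∫ s in h..(h + d), f s)
      + ∫ s in (0:ℝ)..d, f s := by
    rw [e4, e1]; module
  have e6 : 2 * ‖I‖ = ‖(2:ℂ) • I‖ := by rw [norm_smul]; simp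
  rw [e6, e5]
  refine (norm_add_le _ _).trans ?_
  have := norm_sub_le (∫ s in (0:ℝ)..h, (f s + f (s + d))) (∫ s in h..(h + d), f s)
  linarith

theorem stmt5 (X : Type*) [NormedAddCommGroup X] [NormedSpace ℂ X] [CompleteSpace X]
    (φ : ℝ → X) (hφ : UniformContinuous φ) (hφb : ∃ C, ∀ t, ‖φ t‖ ≤ C)
    (h : ℝ) (hh : 0 < h) :
    Continuous (fun t : ℝ => (1 / h) • ∫ s in (0:ℝ)..h, g (t + s) • φ (t + s)) ∧
      Tendsto (fun t : ℝ => ‖(1 / h) • ∫ s in (0:ℝ)..h, g (t + s) • φ (t + s)‖)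
        (cocompact ℝ) (nhds 0) := by
  obtain ⟨C, hC⟩ := hφb
  have hc := hφ.continuous
  have gc := g_cont
  constructor
  · refine Continuous.const_smul ?_ _
    apply continuous_parametric_intervalIntegral_of_continuous'
    simp only [Function.uncurry_def]
    fun_prop
  have main : Tendsto (fun t : ℝ => ‖∫ s in (0:ℝ)..h, g (t + s) • φ (t + s)‖)
        (cocompact ℝ) (nhds 0) := by
    have hd : Tendsto (fun t : ℝ => Real.pi / (2 * t)) (cocompact ℝ) (nhds 0) := by
      have := (tendsto_inv₀_cobounded (α := ℝ)).const_mul (Real.pi / 2)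
      rw [mul_zero, Metric.cobounded_eq_cocompact] at this
      refine this.congr fun t => ?_
      rw [div_mul_eq_div_div, div_eq_mul_inv (Real.pi / 2)]
    have hr : Tendsto (fun t : ℝ => (C * (2 * h * |Real.pi / (2 * t)| + |Real.pi / (2 * t)| ^ 2)) * h
        + 2 * (C * |Real.pi / (2 * t)|)) (cocompact ℝ) (nhds 0) := by
      have hcont : Continuous (fun d : ℝ => (C * (2 * h * |d| + |d| ^ 2)) * h + 2 * (C * |d|)) := by
        fun_prop
      have := (hcont.tendsto 0).comp hd
      simpa [Function.comp_def] using this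
    rw [Metric.tendsto_nhds]
    intro ε hε
    obtain ⟨δ, hδ, hu⟩ := Metric.uniformContinuous_iff.1 hφ (ε / h) (by positivity)
    have h0 : ∀ᶠ t : ℝ in cocompact ℝ, t ≠ 0 := by
      have := (isCompact_singleton (x := (0:ℝ))).compl_mem_cocompact
      filter_upwards [this] with t ht using ht
    filter_upwards [h0, Metric.tendsto_nhds.1 hd δ hδ, Metric.tendsto_nhds.1 hr ε hε]
      with t ht h1 h2
    have k := key_bound φ hc C hC h hh t ht _ rfl (ε / h) (fun u => by
      rw [← dist_eq_norm]
      exact (hu (by simpa [dist_eq_norm] using h1)).le)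
    rw [dist_zero_right, Real.norm_eq_abs] at h2 ⊢
    rw [abs_norm]
    have h3 := (abs_lt.1 h2).2
    have h4 : ε / h * h = ε := by field_simp
    rw [add_mul, h4] at k
    linarith
  have := main.const_mul ‖(1 / h : ℝ)‖
  rw [mul_zero] at this
  exact this.congr fun t => (norm_smul _ _).symm
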